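/- In any divisive arithmetical meadow, 1/(1/x) = x and (x·y)/(z·w) = (x/z)·(y/w) for all x, y, z, w. -/

import Mathlib

structure DAMeadow (M : Type*) where
  add : M → M → M
  mul : M → M → M
  one : M
  div : M → M → M
  add_assoc : ∀ x y z, add (add x y) z = add x (add y z)
  add_comm : ∀ x y, add x y = add y x
  mul_assoc : ∀ x y z, mul (mul x y) z = mul x (mul y z)
  mul_comm : ∀ x y, mul x y = mul y x
  mul_one : ∀ x, mul x one = x
  mul_add : ∀ x y z, mul x (add y z) = add (mul x y) (mul x z)
  div_self : ∀ x, div x x = one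
  div_def : ∀ x y, div x y = mul x (div one y)

namespace DAMeadow

variable {M : Type*} (A : DAMeadow M)

theorem mul_one_div (x : M) : A.mul x (A.div A.one x) = A.one := by
  rw [← A.div_def, A.div_self]

theorem one_mul (x : M) : A.mul A.one x = x := by
  rw [A.mul_comm, A.mul_one]

theorem mul_mul_mul_comm (x y z w : M) :
    A.mul (A.mul x y) (A.mul z w) = A.mul (A.mul x z) (A.mul y w) := by
  rw [A.mul_assoc, ← A.mul_assoc y, A.mul_comm y z, A.mul_assoc z, ← A.mul_assoc x]

theorem one_div_eq_of_mul_eq_one {x y : M} (h : A.mul x y = A.one) : A.div A.one x = y := by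
  calc
    A.div A.one x = A.mul (A.div A.one x) (A.mul x y) := by rw [h, A.mul_one]
    _ = y := by rw [← A.mul_assoc, A.mul_comm _ x, A.mul_one_div, A.one_mul]

theorem one_div_mul (x y : M) :
    A.div A.one (A.mul x y) = A.mul (A.div A.one x) (A.div A.one y) := by
  apply A.one_div_eq_of_mul_eq_one
  rw [A.mul_mul_mul_comm, A.mul_one_div, A.mul_one_div, A.mul_one]

end DAMeadow

theorem dameadow_props {M : Type*} (A : DAMeadow M) :
    (∀ x, A.div A.one (A.div A.one x) = x) ∧
    (∀ x y z w, A.div (A.mul x y) (A.mul z w) = A.mul (A.div x z) (A.div y w)) := by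
  refine ⟨fun x => A.one_div_eq_of_mul_eq_one ?_, fun x y z w => ?_⟩
  · rw [A.mul_comm, A.mul_one_div]
  · rw [A.div_def, A.one_div_mul, A.mul_mul_mul_comm, ← A.div_def, ← A.div_def]
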